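/- arXiv:2406.01343 — 5 statements merged into one kernel-verified Lean document; each statement's English description precedes it below -/
import Mathlib

section
/- Fix a convex set K ⊆ ℝ with 0 in the interior of K, and a continuous map I : B₀(Σ,K) → ℝ (continuity with respect to the supremum norm). Then I is constant superadditive if and only if I(αφ + (1−α)k) ≥ I(αφ) + (1−α)k for all α ∈ [0,1], all φ ∈ B₀(Σ,K), and all k ∈ K with k ≥ 0. -/
variable {S : Type*} [MeasurableSpace S]

/-- `B₀(Σ,K)`: the set of Σ-measurable simple (finite-range) functions `φ : S → ℝ`
with values in `K`. -/
def B0 (K : Set ℝ) : Set (S → ℝ) :=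
  {φ | Measurable φ ∧ (Set.range φ).Finite ∧ Set.range φ ⊆ K}

/-- `I` is constant superadditive on `B₀(Σ,K)`. -/
def ConstSuperadd (K : Set ℝ) (I : (S → ℝ) → ℝ) : Prop :=
  ∀ φ : S → ℝ, φ ∈ B0 K → ∀ k : ℝ, 0 ≤ k → (fun s => φ s + k) ∈ B0 K →
    I φ + k ≤ I (fun s => φ s + k)

/-- `I` is continuous on `B₀(Σ,K)` with respect to the supremum norm. -/
def SupNormContinuous (K : Set ℝ) (I : (S → ℝ) → ℝ) : Prop :=
  ∀ φ : S → ℝ, φ ∈ B0 K → ∀ ε : ℝ, 0 < ε → ∃ δ > (0 : ℝ), ∀ ψ : S → ℝ, ψ ∈ B0 K →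
    (∀ s, |ψ s - φ s| ≤ δ) → |I ψ - I φ| ≤ ε

open Filter Topology in
/-- A sup-norm continuous functional on `B₀(Σ,K)` is continuous along rays at scale one. -/
theorem SupNormContinuous.tendsto_smul {K : Set ℝ} (hK : Convex ℝ K) (h0 : (0 : ℝ) ∈ K)
    {I : (S → ℝ) → ℝ} (hI : SupNormContinuous K I) {φ : S → ℝ} (hφ : φ ∈ B0 K) :
    Tendsto (fun t : ℝ => I (fun s => t * φ s)) (𝓝[<] 1) (𝓝 (I φ)) := by
  obtain ⟨M, hM⟩ := hφ.2.1.isBounded.exists_norm_le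
  have hM' : ∀ s, |φ s| ≤ |M| := fun s => (hM _ ⟨s, rfl⟩).trans (le_abs_self M)
  rw [Metric.tendsto_nhds]
  intro ε hε
  obtain ⟨δ, hδ, h⟩ := hI φ hφ (ε / 2) (half_pos hε)
  have h1 : ∀ᶠ t : ℝ in 𝓝[<] 1, |t - 1| * |M| < δ := by
    have hc : Tendsto (fun t : ℝ => |t - 1| * |M|) (𝓝 1) (𝓝 (|1 - 1| * |M|)) :=
      Continuous.tendsto (by fun_prop) 1
    exact (hc.mono_left nhdsWithin_le_nhds).eventually_lt_const (by simpa using hδ)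
  filter_upwards [h1, Ioo_mem_nhdsLT (zero_lt_one (α := ℝ))] with t ht1 ht
  rw [Real.dist_eq]
  refine (h _ ⟨hφ.1.const_mul t, ?_, ?_⟩ fun s => ?_).trans_lt (half_lt_self hε)
  · exact (hφ.2.1.image (t * ·)).subset (by rintro _ ⟨s, rfl⟩; exact ⟨φ s, ⟨s, rfl⟩, rfl⟩)
  · rintro _ ⟨s, rfl⟩
    exact hK.smul_mem_of_zero_mem h0 (hφ.2.2 ⟨s, rfl⟩) ⟨ht.1.le, ht.2.le⟩
  · calc |t * φ s - φ s| = |t - 1| * |φ s| := by rw [← abs_mul]; ring_nf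
      _ ≤ |t - 1| * |M| := mul_le_mul_of_nonneg_left (hM' s) (abs_nonneg _)
      _ ≤ δ := ht1.le

/-- An affine image of a function in `B₀(Σ,K)` is in `B₀(Σ,K)` if its values are in `K`. -/
theorem B0.affine_mem {K : Set ℝ} {φ : S → ℝ} (hφ : φ ∈ B0 K) (a b : ℝ)
    (h : ∀ s, a * φ s + b ∈ K) : (fun s => a * φ s + b) ∈ B0 K := by
  refine ⟨(hφ.1.const_mul a).add_const b, ?_, ?_⟩
  · exact (hφ.2.1.image (a * · + b)).subset (by rintro _ ⟨s, rfl⟩; exact ⟨φ s, ⟨s, rfl⟩, rfl⟩)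
  · rintro _ ⟨s, rfl⟩
    exact h s

/-- Constant superadditivity on `t • B₀(Σ,K)` for `0 < t < 1`, by iterating small steps. -/
theorem add_le_of_scaled {K : Set ℝ} (hK : Convex ℝ K) (h0 : (0 : ℝ) ∈ interior K)
    {I : (S → ℝ) → ℝ}
    (h : ∀ α : ℝ, α ∈ Set.Icc (0 : ℝ) 1 → ∀ φ : S → ℝ, φ ∈ B0 K → ∀ k : ℝ, k ∈ K → 0 ≤ k →
      I (fun s => α * φ s) + (1 - α) * k ≤ I (fun s => α * φ s + (1 - α) * k))
    {φ : S → ℝ} (hφ : φ ∈ B0 K) {k : ℝ} (hk : 0 ≤ k) (hφk : (fun s => φ s + k) ∈ B0 K)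
    {t : ℝ} (ht : t ∈ Set.Ioo (0 : ℝ) 1) :
    I (fun s => t * φ s) + t * k ≤ I (fun s => t * (φ s + k)) := by
  have ht1 : 0 < 1 - t := sub_pos.2 ht.2
  obtain ⟨n, hnK, hn⟩ : ∃ n : ℕ, t * k / (1 - t) / n ∈ K ∧ 0 < n :=
    (((tendsto_const_div_atTop_nhds_zero_nat (t * k / (1 - t))).eventually
      (mem_interior_iff_mem_nhds.1 h0)).and (Filter.eventually_gt_atTop 0)).exists
  have hn' : (0 : ℝ) < n := by exact_mod_cast hn
  have step : ∀ j : ℕ, j ≤ n →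
      I (fun s => t * φ s) + t * (j * (k / n)) ≤ I (fun s => t * (φ s + j * (k / n))) := by
    intro j
    induction j with
    | zero => simp
    | succ j ih =>
      intro hj
      have hjn : (j : ℝ) ≤ n := by exact_mod_cast (Nat.le_of_succ_le hj)
      have hmem : (fun s => 1 * φ s + j * (k / n)) ∈ B0 K := by
        refine B0.affine_mem hφ _ _ fun s => ?_
        have := hK.add_smul_mem (hφ.2.2 ⟨s, rfl⟩) (hφk.2.2 ⟨s, rfl⟩)
          (t := (j : ℝ) / n) ⟨by positivity, (div_le_one hn').2 hjn⟩
        convert this using 1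
        rw [smul_eq_mul]
        ring
      have hs := h t ⟨ht.1.le, ht.2.le⟩ _ hmem _ hnK (by have := ht.1; positivity)
      have e : (1 - t) * (t * k / (1 - t) / n) = t * (k / n) := by field_simp
      have e2 : (fun s => t * (φ s + ((j + 1 : ℕ) : ℝ) * (k / n))) =
          fun s => t * (1 * φ s + j * (k / n)) + t * (k / n) := by
        funext s; push_cast; ring
      rw [e] at hs
      rw [e2]
      have ih' := ih (Nat.le_of_succ_le hj)
      simp only [one_mul] at hs ⊢
      push_cast
      linarith
  have := step n le_rfl
  rwa [mul_div_cancel₀ k hn'.ne'] at this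

/-- for `K ⊆ ℝ` convex with `0` in its interior and `I` sup-norm continuous,
`I` is constant superadditive iff `I(αφ + (1−α)k) ≥ I(αφ) + (1−α)k` for all `α ∈ [0,1]`,
`φ ∈ B₀(Σ,K)`, and `k ∈ K` with `k ≥ 0`. -/
theorem stmt_1 (K : Set ℝ) (hK : Convex ℝ K) (h0 : (0 : ℝ) ∈ interior K)
    (I : (S → ℝ) → ℝ) (hI : SupNormContinuous K I) :
    ConstSuperadd K I ↔
      (∀ α : ℝ, α ∈ Set.Icc (0 : ℝ) 1 → ∀ φ : S → ℝ, φ ∈ B0 K → ∀ k : ℝ, k ∈ K → 0 ≤ k →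
        I (fun s => α * φ s) + (1 - α) * k ≤ I (fun s => α * φ s + (1 - α) * k)) := by
  have h0K := interior_subset h0
  constructor
  · intro h α hα φ hφ k hk hk0
    have h1 := B0.affine_mem hφ α 0 fun s => by
      simpa using hK.smul_mem_of_zero_mem h0K (hφ.2.2 ⟨s, rfl⟩) hα
    have h2 := B0.affine_mem hφ α ((1 - α) * k) fun s =>
      hK (hφ.2.2 ⟨s, rfl⟩) hk hα.1 (sub_nonneg.2 hα.2) (add_sub_cancel _ _)
    simp only [add_zero] at h1
    exact h _ h1 _ (mul_nonneg (sub_nonneg.2 hα.2) hk0) h2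
  · intro h φ hφ k hk hφk
    have hlin : Filter.Tendsto (fun t : ℝ => t * k) (nhdsWithin 1 (Set.Iio 1)) (nhds k) := by
      have : Filter.Tendsto (fun t : ℝ => t * k) (nhds 1) (nhds (1 * k)) :=
        Continuous.tendsto (by fun_prop) 1
      rw [one_mul] at this
      exact this.mono_left nhdsWithin_le_nhds
    refine le_of_tendsto_of_tendsto ((hI.tendsto_smul hK h0K hφ).add hlin)
      (hI.tendsto_smul hK h0K hφk) ?_
    filter_upwards [Ioo_mem_nhdsLT (zero_lt_one (α := ℝ))] with t ht
    exact add_le_of_scaled hK h0 h hφ hk hφk ht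
end

section
/- Let K ⊆ ℝ be an interval and T : B₀(Σ,K) → ℝ a constant superadditive, monotone, and normalized map. Then the map T̃ : B₀(Σ,K_∞) → ℝ̄ defined by T̃(ψ) = sup{ T(φ) + m : φ ∈ B₀(Σ,K), m ≥ 0, φ + m ≤ ψ pointwise } is real-valued and is a constant superadditive, monotone, and normalized extension of T to B₀(Σ,K_∞) (i.e., T̃(ψ) = T(ψ) for every ψ ∈ B₀(Σ,K)). -/
variable {S : Type*} [MeasurableSpace S]

/-- `I` is monotone on `B₀(Σ,K)`. -/
def MonotoneOnB0 (K : Set ℝ) (I : (S → ℝ) → ℝ) : Prop :=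
  ∀ φ : S → ℝ, φ ∈ B0 K → ∀ ψ : S → ℝ, ψ ∈ B0 K → (∀ s, ψ s ≤ φ s) → I ψ ≤ I φ

/-- `I` is normalized on `B₀(Σ,K)`. -/
def NormalizedOnB0 (K : Set ℝ) (I : (S → ℝ) → ℝ) : Prop :=
  ∀ k ∈ K, I (fun _ => k) = k

-- `K_∞ := K ∪ [sup K, ∞)` when `K` is bounded above, and `K_∞ := K` otherwise.
open Classical in
noncomputable def Kinf (K : Set ℝ) : Set ℝ :=
  if BddAbove K then K ∪ Set.Ici (sSup K) else K

/-- The extension `T̃(ψ) = sup{ T(φ) + m : φ ∈ B₀(Σ,K), m ≥ 0, φ + m ≤ ψ }`. -/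
noncomputable def Text (K : Set ℝ) (T : (S → ℝ) → ℝ) (ψ : S → ℝ) : EReal :=
  sSup {y : EReal | ∃ φ ∈ B0 (S := S) K, ∃ m : ℝ, 0 ≤ m ∧ (∀ s, φ s + m ≤ ψ s) ∧
    y = ((T φ + m : ℝ) : EReal)}

theorem const_mem_B0 {K : Set ℝ} {k : ℝ} (hk : k ∈ K) : (fun _ : S => k) ∈ B0 (S := S) K :=
  ⟨measurable_const, Set.finite_range_const,
    (Set.range_const_subset).trans (Set.singleton_subset_iff.2 hk)⟩

theorem B0_nonneg_add_mem {K : Set ℝ} (hK : Convex ℝ K) {φ ψ : S → ℝ} (hφ : φ ∈ B0 K)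
    (hψ : ψ ∈ B0 K) {m : ℝ} (hm : 0 ≤ m) (hle : ∀ s, φ s + m ≤ ψ s) :
    (fun s => φ s + m) ∈ B0 K := by
  refine ⟨hφ.1.add_const m, ?_, ?_⟩
  · exact (hφ.2.1.image (· + m)).subset (by rintro _ ⟨s, rfl⟩; exact ⟨φ s, ⟨s, rfl⟩, rfl⟩)
  · rintro _ ⟨s, rfl⟩
    exact hK.ordConnected.out (hφ.2.2 ⟨s, rfl⟩) (hψ.2.2 ⟨s, rfl⟩)
      ⟨le_add_of_nonneg_right hm, hle s⟩

theorem B0_exists_forall_le [Nonempty S] {K : Set ℝ} {φ : S → ℝ} (hφ : φ ∈ B0 K) :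
    ∃ s₀, ∀ s, φ s ≤ φ s₀ := by
  obtain ⟨_, ⟨s₀, rfl⟩, h⟩ := hφ.2.1.exists_maximal (Set.range_nonempty φ)
  exact ⟨s₀, fun s => (le_total (φ s) (φ s₀)).elim id fun h' => h ⟨s, rfl⟩ h'⟩

theorem B0_exists_forall_ge [Nonempty S] {K : Set ℝ} {φ : S → ℝ} (hφ : φ ∈ B0 K) :
    ∃ s₀, ∀ s, φ s₀ ≤ φ s := by
  obtain ⟨_, ⟨s₀, rfl⟩, h⟩ := hφ.2.1.exists_minimal (Set.range_nonempty φ)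
  exact ⟨s₀, fun s => (le_total (φ s₀) (φ s)).elim id fun h' => h ⟨s, rfl⟩ h'⟩

theorem exists_mem_le_of_mem_Kinf {K : Set ℝ} (hne : K.Nonempty) {c : ℝ} (hc : c ∈ Kinf K) :
    ∃ k ∈ K, k ≤ c := by
  unfold Kinf at hc
  split_ifs at hc with hb
  · rcases hc with hc | hc
    · exact ⟨c, hc, le_rfl⟩
    · obtain ⟨k, hk⟩ := hne
      exact ⟨k, hk, (le_csSup hb hk).trans hc⟩
  · exact ⟨c, hc, le_rfl⟩

theorem le_Text {K : Set ℝ} {T : (S → ℝ) → ℝ} {φ ψ : S → ℝ} (hφ : φ ∈ B0 K) {m : ℝ}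
    (hm : 0 ≤ m) (hle : ∀ s, φ s + m ≤ ψ s) : ((T φ + m : ℝ) : EReal) ≤ Text K T ψ :=
  le_sSup ⟨φ, hφ, m, hm, hle, rfl⟩

theorem Text_le {K : Set ℝ} {T : (S → ℝ) → ℝ} {ψ : S → ℝ} {x : ℝ}
    (h : ∀ φ ∈ B0 (S := S) K, ∀ m : ℝ, 0 ≤ m → (∀ s, φ s + m ≤ ψ s) → T φ + m ≤ x) :
    Text K T ψ ≤ (x : EReal) := by
  refine sSup_le ?_
  rintro _ ⟨φ, hφ, m, hm, hle, rfl⟩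
  exact EReal.coe_le_coe_iff.2 (h φ hφ m hm hle)

theorem Text_mono {K : Set ℝ} {T : (S → ℝ) → ℝ} {χ ψ : S → ℝ} (h : ∀ s, χ s ≤ ψ s) :
    Text K T χ ≤ Text K T ψ := by
  refine sSup_le_sSup ?_
  rintro _ ⟨φ, hφ, m, hm, hle, rfl⟩
  exact ⟨φ, hφ, m, hm, fun s => (hle s).trans (h s), rfl⟩

theorem Text_le_of_forall_le [Nonempty S] {K : Set ℝ} {T : (S → ℝ) → ℝ}
    (hmon : MonotoneOnB0 K T) (hnorm : NormalizedOnB0 K T) {ψ : S → ℝ} {M : ℝ}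
    (hM : ∀ s, ψ s ≤ M) : Text K T ψ ≤ (M : EReal) := by
  refine Text_le fun φ hφ m _ hle => ?_
  obtain ⟨s₀, hs₀⟩ := B0_exists_forall_le hφ
  have hmem : φ s₀ ∈ K := hφ.2.2 ⟨s₀, rfl⟩
  have := hmon _ (const_mem_B0 hmem) φ hφ hs₀
  rw [hnorm _ hmem] at this
  linarith [hle s₀, hM s₀]

theorem Text_const [Nonempty S] {K : Set ℝ} (hne : K.Nonempty) {T : (S → ℝ) → ℝ}
    (hmon : MonotoneOnB0 K T) (hnorm : NormalizedOnB0 K T) {c : ℝ} (hc : c ∈ Kinf K) :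
    Text K T (fun _ => c) = (c : EReal) := by
  refine le_antisymm (Text_le_of_forall_le hmon hnorm fun _ => le_rfl) ?_
  obtain ⟨k, hk, hkc⟩ := exists_mem_le_of_mem_Kinf hne hc
  have := le_Text (T := T) (ψ := fun _ => c) (const_mem_B0 hk) (sub_nonneg.2 hkc)
    fun _ => (add_sub_cancel k c).le
  rwa [hnorm k hk, add_sub_cancel] at this

theorem Text_eq_coe [Nonempty S] {K : Set ℝ} (hne : K.Nonempty) {T : (S → ℝ) → ℝ}
    (hmon : MonotoneOnB0 K T) (hnorm : NormalizedOnB0 K T) {ψ : S → ℝ}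
    (hψ : ψ ∈ B0 (Kinf K)) : ∃ r : ℝ, Text K T ψ = (r : EReal) := by
  obtain ⟨s₀, hs₀⟩ := B0_exists_forall_le hψ
  obtain ⟨s₁, hs₁⟩ := B0_exists_forall_ge hψ
  have hlow : ((ψ s₁ : ℝ) : EReal) ≤ Text K T ψ :=
    (Text_const hne hmon hnorm (hψ.2.2 ⟨s₁, rfl⟩)).ge.trans (Text_mono hs₁)
  have hupp := Text_le_of_forall_le hmon hnorm hs₀
  exact ⟨_, (EReal.coe_toReal (ne_top_of_le_ne_top (EReal.coe_ne_top _) hupp)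
    (ne_bot_of_le_ne_bot (EReal.coe_ne_bot _) hlow)).symm⟩

theorem Text_eq_of_mem {K : Set ℝ} (hK : Convex ℝ K) {T : (S → ℝ) → ℝ}
    (hsup : ConstSuperadd K T) (hmon : MonotoneOnB0 K T) {ψ : S → ℝ} (hψ : ψ ∈ B0 K) :
    Text K T ψ = ((T ψ : ℝ) : EReal) := by
  refine le_antisymm (Text_le fun φ hφ m hm hle => ?_) ?_
  · have hadd := B0_nonneg_add_mem hK hφ hψ hm hle
    exact (hsup φ hφ m hm hadd).trans (hmon ψ hψ _ hadd hle)
  · simpa using le_Text (T := T) hψ le_rfl fun s => (add_zero (ψ s)).le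

/-- if `K` is a (nonempty) interval and `T : B₀(Σ,K) → ℝ` is constant
superadditive, monotone, and normalized, then `T̃` is real-valued on `B₀(Σ,K_∞)` and is a
constant superadditive, monotone, and normalized extension of `T` to `B₀(Σ,K_∞)`. -/
theorem stmt_3 [Nonempty S] (K : Set ℝ) (hne : K.Nonempty) (hK : Convex ℝ K)
    (T : (S → ℝ) → ℝ) (hsup : ConstSuperadd K T) (hmon : MonotoneOnB0 K T)
    (hnorm : NormalizedOnB0 K T) :
    (∀ ψ : S → ℝ, ψ ∈ B0 (Kinf K) → ∃ r : ℝ, Text K T ψ = (r : EReal)) ∧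
    (∀ ψ : S → ℝ, ψ ∈ B0 K → Text K T ψ = ((T ψ : ℝ) : EReal)) ∧
    (∀ ψ : S → ℝ, ψ ∈ B0 (Kinf K) → ∀ χ : S → ℝ, χ ∈ B0 (Kinf K) → (∀ s, χ s ≤ ψ s) →
      Text K T χ ≤ Text K T ψ) ∧
    (∀ k ∈ Kinf K, Text K T (fun _ => k) = (k : EReal)) ∧
    (∀ ψ : S → ℝ, ψ ∈ B0 (Kinf K) → ∀ k : ℝ, 0 ≤ k →
      (fun s => ψ s + k) ∈ B0 (Kinf K) →
      Text K T ψ + (k : EReal) ≤ Text K T (fun s => ψ s + k)) := by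
  refine ⟨fun ψ hψ => Text_eq_coe hne hmon hnorm hψ, fun ψ hψ => Text_eq_of_mem hK hsup hmon hψ,
    fun ψ _ χ _ h => Text_mono h, fun k hk => Text_const hne hmon hnorm hk,
    fun ψ hψ k hk hψk => ?_⟩
  obtain ⟨r, hr⟩ := Text_eq_coe hne hmon hnorm hψ
  obtain ⟨q, hq⟩ := Text_eq_coe hne hmon hnorm hψk
  have hle : Text K T ψ ≤ ((q - k : ℝ) : EReal) := by
    refine Text_le fun φ hφ m hm hφψ => ?_
    have := le_Text (T := T) (ψ := fun s => ψ s + k) hφ (add_nonneg hm hk)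
      fun s => by linarith [hφψ s]
    rw [hq, EReal.coe_le_coe_iff] at this
    linarith
  rw [hr, EReal.coe_le_coe_iff] at hle
  rw [hr, hq, ← EReal.coe_add, EReal.coe_le_coe_iff]
  linarith
end

section
/- Fix a convex set K ⊆ ℝ and a monotone and normalized map I : B₀(Σ,K) → ℝ̄. Then for every ξ ∈ B₀(Σ,K): (i) the auxiliary functionals I_ξ, J_ξ, S_ξ, and H_ξ are monotone; (ii) I_ξ(φ) ≥ I(φ), J_ξ(φ) ≥ I(φ), S_ξ(φ) ≤ I(φ), and H_ξ(φ) ≤ I(φ) for every φ ∈ B₀(Σ,K); (iii) I_ξ is quasiconvex and S_ξ is quasiconcave. -/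
variable {S : Type*} [MeasurableSpace S]

/-- An extended-real-valued `I` is monotone on `B₀(Σ,K)`. -/
def EMonotoneOnB0 (K : Set ℝ) (I : (S → ℝ) → EReal) : Prop :=
  ∀ φ : S → ℝ, φ ∈ B0 K → ∀ ψ : S → ℝ, ψ ∈ B0 K → (∀ s, ψ s ≤ φ s) → I ψ ≤ I φ

/-- An extended-real-valued `I` is normalized on `B₀(Σ,K)`. -/
def ENormalizedOnB0 (K : Set ℝ) (I : (S → ℝ) → EReal) : Prop :=
  ∀ k ∈ K, I (fun _ => k) = (k : EReal)

/-- `I` is quasiconvex on `B₀(Σ,K)`. -/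
def EQuasiconvexOnB0 (K : Set ℝ) (I : (S → ℝ) → EReal) : Prop :=
  ∀ α : ℝ, α ∈ Set.Icc (0 : ℝ) 1 → ∀ φ : S → ℝ, φ ∈ B0 K → ∀ ψ : S → ℝ, ψ ∈ B0 K →
    I (fun s => α * φ s + (1 - α) * ψ s) ≤ max (I φ) (I ψ)

/-- `I` is quasiconcave on `B₀(Σ,K)`. -/
def EQuasiconcaveOnB0 (K : Set ℝ) (I : (S → ℝ) → EReal) : Prop :=
  ∀ α : ℝ, α ∈ Set.Icc (0 : ℝ) 1 → ∀ φ : S → ℝ, φ ∈ B0 K → ∀ ψ : S → ℝ, ψ ∈ B0 K →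
    min (I φ) (I ψ) ≤ I (fun s => α * φ s + (1 - α) * ψ s)

/-- The auxiliary functional `I_ξ(φ) = inf{ I(ξ+k) : ξ+k ∈ B₀(Σ,K), ξ+k ≥ φ }`
(with `inf ∅ = +∞`). -/
noncomputable def Iaux (K : Set ℝ) (I : (S → ℝ) → EReal) (ξ φ : S → ℝ) : EReal :=
  sInf {y : EReal | ∃ k : ℝ, (fun s => ξ s + k) ∈ B0 (S := S) K ∧
    (∀ s, φ s ≤ ξ s + k) ∧ y = I (fun s => ξ s + k)}

/-- The auxiliary functional `J_ξ(φ) = inf{ I(αξ) : α > 0, αξ ∈ B₀(Σ,K), αξ ≥ φ }`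
(with `inf ∅ = +∞`). -/
noncomputable def Jaux (K : Set ℝ) (I : (S → ℝ) → EReal) (ξ φ : S → ℝ) : EReal :=
  sInf {y : EReal | ∃ α : ℝ, 0 < α ∧ (fun s => α * ξ s) ∈ B0 (S := S) K ∧
    (∀ s, φ s ≤ α * ξ s) ∧ y = I (fun s => α * ξ s)}

/-- The auxiliary functional `S_ξ(φ) = sup{ I(ξ+k) : ξ+k ∈ B₀(Σ,K), φ ≥ ξ+k }`
(with `sup ∅ = −∞`). -/
noncomputable def Saux (K : Set ℝ) (I : (S → ℝ) → EReal) (ξ φ : S → ℝ) : EReal :=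
  sSup {y : EReal | ∃ k : ℝ, (fun s => ξ s + k) ∈ B0 (S := S) K ∧
    (∀ s, ξ s + k ≤ φ s) ∧ y = I (fun s => ξ s + k)}

/-- The auxiliary functional `H_ξ(φ) = sup{ I(αξ) : α > 0, αξ ∈ B₀(Σ,K), φ ≥ αξ }`
(with `sup ∅ = −∞`). -/
noncomputable def Haux (K : Set ℝ) (I : (S → ℝ) → EReal) (ξ φ : S → ℝ) : EReal :=
  sSup {y : EReal | ∃ α : ℝ, 0 < α ∧ (fun s => α * ξ s) ∈ B0 (S := S) K ∧
    (∀ s, α * ξ s ≤ φ s) ∧ y = I (fun s => α * ξ s)}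

/-- for a convex `K ⊆ ℝ` and a monotone, normalized `I : B₀(Σ,K) → ℝ̄`,
for every `ξ ∈ B₀(Σ,K)`: (i) `I_ξ, J_ξ, S_ξ, H_ξ` are monotone; (ii) `I_ξ ≥ I`, `J_ξ ≥ I`,
`S_ξ ≤ I`, `H_ξ ≤ I` on `B₀(Σ,K)`; (iii) `I_ξ` is quasiconvex and `S_ξ` is quasiconcave. -/
theorem stmt_5 (K : Set ℝ) (hK : Convex ℝ K) (I : (S → ℝ) → EReal)
    (hmon : EMonotoneOnB0 K I) (hnorm : ENormalizedOnB0 K I) :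
    ∀ ξ : S → ℝ, ξ ∈ B0 K →
      (EMonotoneOnB0 K (Iaux K I ξ) ∧ EMonotoneOnB0 K (Jaux K I ξ) ∧
        EMonotoneOnB0 K (Saux K I ξ) ∧ EMonotoneOnB0 K (Haux K I ξ)) ∧
      (∀ φ : S → ℝ, φ ∈ B0 K →
        I φ ≤ Iaux K I ξ φ ∧ I φ ≤ Jaux K I ξ φ ∧
          Saux K I ξ φ ≤ I φ ∧ Haux K I ξ φ ≤ I φ) ∧
      (EQuasiconvexOnB0 K (Iaux K I ξ) ∧ EQuasiconcaveOnB0 K (Saux K I ξ)) := by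
  intro ξ _
  refine ⟨⟨?_, ?_, ?_, ?_⟩, ?_, ?_, ?_⟩
  · intro φ _ ψ _ h
    apply sInf_le_sInf
    rintro y ⟨k, hk, hle, rfl⟩
    exact ⟨k, hk, fun s => (h s).trans (hle s), rfl⟩
  · intro φ _ ψ _ h
    apply sInf_le_sInf
    rintro y ⟨a, ha, hB, hle, rfl⟩
    exact ⟨a, ha, hB, fun s => (h s).trans (hle s), rfl⟩
  · intro φ _ ψ _ h
    apply sSup_le_sSup
    rintro y ⟨k, hk, hle, rfl⟩
    exact ⟨k, hk, fun s => (hle s).trans (h s), rfl⟩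
  · intro φ _ ψ _ h
    apply sSup_le_sSup
    rintro y ⟨a, ha, hB, hle, rfl⟩
    exact ⟨a, ha, hB, fun s => (hle s).trans (h s), rfl⟩
  · intro φ hφ
    refine ⟨le_sInf ?_, le_sInf ?_, sSup_le ?_, sSup_le ?_⟩
    · rintro y ⟨k, hk, hle, rfl⟩
      exact hmon _ hk _ hφ hle
    · rintro y ⟨a, _, hB, hle, rfl⟩
      exact hmon _ hB _ hφ hle
    · rintro y ⟨k, hk, hle, rfl⟩
      exact hmon _ hφ _ hk hle
    · rintro y ⟨a, _, hB, hle, rfl⟩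
      exact hmon _ hφ _ hB hle
  · intro a ha φ _ ψ _
    by_contra! hlt
    obtain ⟨hlt₁, hlt₂⟩ := max_lt_iff.mp hlt
    obtain ⟨_, ⟨k, hk, hφk, rfl⟩, hIk⟩ := sInf_lt_iff.mp hlt₁
    obtain ⟨_, ⟨l, hl, hψl, rfl⟩, hIl⟩ := sInf_lt_iff.mp hlt₂
    rcases le_total k l with hkl | hlk
    · refine hIl.not_ge (sInf_le ⟨l, hl, fun s => ?_, rfl⟩)
      nlinarith [ha.1, ha.2, hφk s, hψl s]
    · refine hIk.not_ge (sInf_le ⟨k, hk, fun s => ?_, rfl⟩)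
      nlinarith [ha.1, ha.2, hφk s, hψl s]
  · intro a ha φ _ ψ _
    by_contra! hlt
    obtain ⟨hlt₁, hlt₂⟩ := lt_min_iff.mp hlt
    obtain ⟨_, ⟨k, hk, hφk, rfl⟩, hIk⟩ := lt_sSup_iff.mp hlt₁
    obtain ⟨_, ⟨l, hl, hψl, rfl⟩, hIl⟩ := lt_sSup_iff.mp hlt₂
    rcases le_total k l with hkl | hlk
    · refine hIk.not_ge (le_sSup ⟨k, hk, fun s => ?_, rfl⟩)
      nlinarith [ha.1, ha.2, hφk s, hψl s]
    · refine hIl.not_ge (le_sSup ⟨l, hl, fun s => ?_, rfl⟩)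
      nlinarith [ha.1, ha.2, hφk s, hψl s]
end

section
/- Fix a convex set K ⊆ ℝ with K ⊆ [0,∞) and a monotone and normalized map I : B₀(Σ,K) → ℝ̄. Then for every ξ ∈ B₀(Σ,K), the auxiliary functional J_ξ is quasiconvex and the auxiliary functional H_ξ is quasiconcave. -/
variable {S : Type*} [MeasurableSpace S]

lemma B0.nonneg {K : Set ℝ} (hK : K ⊆ Set.Ici (0 : ℝ)) {φ : S → ℝ} (hφ : φ ∈ B0 K) (s : S) :
    0 ≤ φ s :=
  hK (hφ.2.2 ⟨s, rfl⟩)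

lemma Jaux_le {K : Set ℝ} {I : (S → ℝ) → EReal} {ξ φ : S → ℝ} {a : ℝ} (ha : 0 < a)
    (haξ : (fun s => a * ξ s) ∈ B0 (S := S) K) (h : ∀ s, φ s ≤ a * ξ s) :
    Jaux K I ξ φ ≤ I (fun s => a * ξ s) :=
  sInf_le ⟨a, ha, haξ, h, rfl⟩

lemma le_Haux {K : Set ℝ} {I : (S → ℝ) → EReal} {ξ φ : S → ℝ} {a : ℝ} (ha : 0 < a)
    (haξ : (fun s => a * ξ s) ∈ B0 (S := S) K) (h : ∀ s, a * ξ s ≤ φ s) :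
    I (fun s => a * ξ s) ≤ Haux K I ξ φ :=
  le_sSup ⟨a, ha, haξ, h, rfl⟩

/-- For a nonnegative direction `ξ` the multiples of `ξ` are totally ordered, so the larger of two
dominating multiples dominates every mixture. -/
lemma Jaux_quasiconvex {K : Set ℝ} {I : (S → ℝ) → EReal} {ξ : S → ℝ} (hξ : ∀ s, 0 ≤ ξ s) :
    EQuasiconvexOnB0 K (Jaux K I ξ) := by
  intro α hα φ _ ψ _
  by_contra! hlt
  obtain ⟨hφ, hψ⟩ := max_lt_iff.1 hlt
  obtain ⟨_, ⟨a, ha, haξ, hφa, rfl⟩, hIa⟩ := sInf_lt_iff.1 hφ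
  obtain ⟨_, ⟨b, hb, hbξ, hψb, rfl⟩, hIb⟩ := sInf_lt_iff.1 hψ
  rcases le_total a b with hab | hab
  · refine hIb.not_ge (Jaux_le hb hbξ fun s => ?_)
    exact convex_Iic (b * ξ s) ((hφa s).trans (mul_le_mul_of_nonneg_right hab (hξ s))) (hψb s)
      hα.1 (sub_nonneg.2 hα.2) (add_sub_cancel _ _)
  · refine hIa.not_ge (Jaux_le ha haξ fun s => ?_)
    exact convex_Iic (a * ξ s) (hφa s) ((hψb s).trans (mul_le_mul_of_nonneg_right hab (hξ s)))
      hα.1 (sub_nonneg.2 hα.2) (add_sub_cancel _ _)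

/-- For a nonnegative direction `ξ` the smaller of two dominated multiples of `ξ` is dominated by
every mixture. -/
lemma Haux_quasiconcave {K : Set ℝ} {I : (S → ℝ) → EReal} {ξ : S → ℝ} (hξ : ∀ s, 0 ≤ ξ s) :
    EQuasiconcaveOnB0 K (Haux K I ξ) := by
  intro α hα φ _ ψ _
  by_contra! hlt
  obtain ⟨hφ, hψ⟩ := lt_min_iff.1 hlt
  obtain ⟨_, ⟨a, ha, haξ, hφa, rfl⟩, hIa⟩ := lt_sSup_iff.1 hφ
  obtain ⟨_, ⟨b, hb, hbξ, hψb, rfl⟩, hIb⟩ := lt_sSup_iff.1 hψ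
  rcases le_total a b with hab | hab
  · refine hIa.not_ge (le_Haux ha haξ fun s => ?_)
    exact convex_Ici (a * ξ s) (hφa s) ((mul_le_mul_of_nonneg_right hab (hξ s)).trans (hψb s))
      hα.1 (sub_nonneg.2 hα.2) (add_sub_cancel _ _)
  · refine hIb.not_ge (le_Haux hb hbξ fun s => ?_)
    exact convex_Ici (b * ξ s) ((mul_le_mul_of_nonneg_right hab (hξ s)).trans (hφa s)) (hψb s)
      hα.1 (sub_nonneg.2 hα.2) (add_sub_cancel _ _)

/-- for a convex `K ⊆ [0,∞)` and a monotone, normalized `I : B₀(Σ,K) → ℝ̄`,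
for every `ξ ∈ B₀(Σ,K)`, `J_ξ` is quasiconvex and `H_ξ` is quasiconcave. -/
theorem stmt_6 (K : Set ℝ) (hK : Convex ℝ K) (hKpos : K ⊆ Set.Ici (0 : ℝ))
    (I : (S → ℝ) → EReal) (hmon : EMonotoneOnB0 K I) (hnorm : ENormalizedOnB0 K I) :
    ∀ ξ : S → ℝ, ξ ∈ B0 K →
      EQuasiconvexOnB0 K (Jaux K I ξ) ∧ EQuasiconcaveOnB0 K (Haux K I ξ) := by
  intro ξ hξ
  exact ⟨Jaux_quasiconvex (B0.nonneg hKpos hξ), Haux_quasiconcave (B0.nonneg hKpos hξ)⟩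
end

section
/- Fix a convex set K ⊆ ℝ and a continuous map I : B₀(Σ,K) → ℝ̄. The following are equivalent: (i) I is monotone, normalized, and constant superadditive; (ii) there exists a family Φ of monotone, constant superadditive, and quasiconvex functionals from B₀(Σ,K) to ℝ̄ such that I(φ) = min_{J∈Φ} J(φ) for all φ ∈ B₀(Σ,K) (with the minimum attained) and min_{J∈Φ} J(k·1_S) = k for all k ∈ K; (iii) there exists a family Ψ of monotone, constant superadditive, and quasiconcave functionals from B₀(Σ,K) to ℝ̄ such that I(φ) = max_{H∈Ψ} H(φ) for all φ ∈ B₀(Σ,K) (with the maximum attained) and max_{H∈Ψ} H(k·1_S) = k for all k ∈ K. -/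
variable {S : Type*} [MeasurableSpace S]

/-- `I` is lower semicontinuous on `B₀(Σ,K)` (sup-norm topology). -/
def ELSCOnB0 (K : Set ℝ) (I : (S → ℝ) → EReal) : Prop :=
  ∀ φ : S → ℝ, φ ∈ B0 K → ∀ b : EReal, b < I φ →
    ∃ δ > (0 : ℝ), ∀ ψ : S → ℝ, ψ ∈ B0 K → (∀ s, |ψ s - φ s| ≤ δ) → b < I ψ

/-- `I` is upper semicontinuous on `B₀(Σ,K)` (sup-norm topology). -/
def EUSCOnB0 (K : Set ℝ) (I : (S → ℝ) → EReal) : Prop :=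
  ∀ φ : S → ℝ, φ ∈ B0 K → ∀ b : EReal, I φ < b →
    ∃ δ > (0 : ℝ), ∀ ψ : S → ℝ, ψ ∈ B0 K → (∀ s, |ψ s - φ s| ≤ δ) → I ψ < b

/-- `I` is continuous on `B₀(Σ,K)` (sup-norm topology on the domain, order topology on `ℝ̄`):
equivalently, it is both lower and upper semicontinuous. -/
def EContinuousOnB0 (K : Set ℝ) (I : (S → ℝ) → EReal) : Prop :=
  ELSCOnB0 K I ∧ EUSCOnB0 K I

/-- An extended-real-valued `I` is constant superadditive on `B₀(Σ,K)`. -/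
def EConstSuperadd (K : Set ℝ) (I : (S → ℝ) → EReal) : Prop :=
  ∀ φ : S → ℝ, φ ∈ B0 K → ∀ k : ℝ, 0 ≤ k → (fun s => φ s + k) ∈ B0 K →
    I φ + (k : EReal) ≤ I (fun s => φ s + k)

/-- A translate of `φ ∈ B₀(Σ,K)` by a constant that stays between two members of `B₀(Σ,K)` is in
`B₀(Σ,K)`. -/
theorem B0.add_const_mem {K : Set ℝ} (hK : Convex ℝ K) {φ ψ : S → ℝ} (hφ : φ ∈ B0 K)
    (hψ : ψ ∈ B0 K) {c : ℝ} (hc : 0 ≤ c) (h : ∀ s, φ s + c ≤ ψ s) :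
    (fun s => φ s + c) ∈ B0 K := by
  refine ⟨hφ.1.add_const c, ?_, ?_⟩
  · exact (hφ.2.1.image (· + c)).subset (by rintro _ ⟨s, rfl⟩; exact ⟨φ s, ⟨s, rfl⟩, rfl⟩)
  · rintro _ ⟨s, rfl⟩
    exact hK.ordConnected.out (hφ.2.2 ⟨s, rfl⟩) (hψ.2.2 ⟨s, rfl⟩)
      ⟨le_add_of_nonneg_right hc, h s⟩

theorem B0.const_mem {K : Set ℝ} {k : ℝ} (hk : k ∈ K) : (fun _ : S => k) ∈ B0 K :=
  ⟨measurable_const, Set.finite_range_const, by rintro _ ⟨_, rfl⟩; exact hk⟩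

/-- For monotone, constant superadditive `I` the value at `φ` plus a nonnegative constant `c`
bounds the value at every `ψ ≥ φ + c` from below. -/
theorem EConstSuperadd.add_le_of_add_le {K : Set ℝ} (hK : Convex ℝ K) {I : (S → ℝ) → EReal}
    (hmono : EMonotoneOnB0 K I) (hadd : EConstSuperadd K I) {φ ψ : S → ℝ} (hφ : φ ∈ B0 K)
    (hψ : ψ ∈ B0 K) {c : ℝ} (hc : 0 ≤ c) (h : ∀ s, φ s + c ≤ ψ s) : I φ + (c : EReal) ≤ I ψ :=
  have hmem := B0.add_const_mem hK hφ hψ hc h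
  (hadd φ hφ c hc hmem).trans (hmono ψ hψ _ hmem h)

/-- The largest functional that is at most `a - c` at every `ψ ≤ φ - c` with `c ≥ 0`. -/
noncomputable def upperEnvelope {X : Type*} (φ : X → ℝ) (a : EReal) (ψ : X → ℝ) : EReal :=
  ⨅ (c : ℝ) (_ : 0 ≤ c ∧ ∀ s, ψ s + c ≤ φ s), a - (c : EReal)

/-- The smallest functional that is at least `a + c` at every `ψ ≥ φ + c` with `c ≥ 0`. -/
noncomputable def lowerEnvelope {X : Type*} (φ : X → ℝ) (a : EReal) (ψ : X → ℝ) : EReal :=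
  ⨆ (c : ℝ) (_ : 0 ≤ c ∧ ∀ s, φ s + c ≤ ψ s), a + (c : EReal)

theorem upperEnvelope_le {X : Type*} {φ ψ : X → ℝ} (a : EReal) {c : ℝ} (hc : 0 ≤ c)
    (h : ∀ s, ψ s + c ≤ φ s) : upperEnvelope φ a ψ ≤ a - (c : EReal) :=
  iInf₂_le c ⟨hc, h⟩

theorem le_lowerEnvelope {X : Type*} {φ ψ : X → ℝ} (a : EReal) {c : ℝ} (hc : 0 ≤ c)
    (h : ∀ s, φ s + c ≤ ψ s) : a + (c : EReal) ≤ lowerEnvelope φ a ψ :=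
  le_iSup₂ (f := fun (c : ℝ) (_ : 0 ≤ c ∧ ∀ s, φ s + c ≤ ψ s) => a + (c : EReal)) c ⟨hc, h⟩

theorem upperEnvelope_self_le {X : Type*} (φ : X → ℝ) (a : EReal) : upperEnvelope φ a φ ≤ a := by
  simpa using upperEnvelope_le (φ := φ) (ψ := φ) a le_rfl (by simp)

theorem le_lowerEnvelope_self {X : Type*} (φ : X → ℝ) (a : EReal) : a ≤ lowerEnvelope φ a φ := by
  simpa using le_lowerEnvelope (φ := φ) (ψ := φ) a le_rfl (by simp)

theorem eMonotoneOnB0_upperEnvelope (K : Set ℝ) (φ : S → ℝ) (a : EReal) :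
    EMonotoneOnB0 K (upperEnvelope φ a) := fun _ _ _ _ hle =>
  le_iInf₂ fun _ hc => upperEnvelope_le a hc.1 fun s => by linarith [hle s, hc.2 s]

theorem eMonotoneOnB0_lowerEnvelope (K : Set ℝ) (φ : S → ℝ) (a : EReal) :
    EMonotoneOnB0 K (lowerEnvelope φ a) := fun _ _ _ _ hle =>
  iSup₂_le fun _ hc => le_lowerEnvelope a hc.1 fun s => by linarith [hle s, hc.2 s]

theorem eConstSuperadd_upperEnvelope (K : Set ℝ) (φ : S → ℝ) (a : EReal) :
    EConstSuperadd K (upperEnvelope φ a) := by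
  intro ψ _ k hk _
  refine le_iInf₂ fun c hc => ?_
  have h := upperEnvelope_le (φ := φ) (ψ := ψ) a (add_nonneg hc.1 hk)
    fun s => by linarith [hc.2 s]
  refine (add_le_add_left h (k : EReal)).trans ?_
  induction a with
  | bot => simp
  | top => simp
  | coe x => norm_cast; linarith

theorem eConstSuperadd_lowerEnvelope (K : Set ℝ) (φ : S → ℝ) (a : EReal) :
    EConstSuperadd K (lowerEnvelope φ a) := by
  intro ψ _ k hk _
  rw [← EReal.le_sub_iff_add_le (by simp) (by simp)]
  refine iSup₂_le fun c hc => ?_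
  rw [EReal.le_sub_iff_add_le (by simp) (by simp), add_assoc, ← EReal.coe_add]
  exact le_lowerEnvelope a (add_nonneg hc.1 hk) fun s => by linarith [hc.2 s]

theorem eQuasiconvexOnB0_upperEnvelope (K : Set ℝ) (φ : S → ℝ) (a : EReal) :
    EQuasiconvexOnB0 K (upperEnvelope φ a) := by
  intro α hα ψ₁ _ ψ₂ _
  refine le_of_forall_gt fun b hb => ?_
  obtain ⟨h₁, h₂⟩ := max_lt_iff.1 hb
  obtain ⟨c₁, ⟨hc₁, hle₁⟩, hb₁⟩ := by simpa only [upperEnvelope, iInf_lt_iff, exists_prop] using h₁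
  obtain ⟨c₂, ⟨hc₂, hle₂⟩, hb₂⟩ := by simpa only [upperEnvelope, iInf_lt_iff, exists_prop] using h₂
  refine (upperEnvelope_le (c := min c₁ c₂) a (le_min hc₁ hc₂) fun s => ?_).trans_lt ?_
  · have hm₁ := mul_le_mul_of_nonneg_left
      ((add_le_add_right (min_le_left c₁ c₂) (ψ₁ s)).trans (hle₁ s)) hα.1
    have hm₂ := mul_le_mul_of_nonneg_left
      ((add_le_add_right (min_le_right c₁ c₂) (ψ₂ s)).trans (hle₂ s)) (sub_nonneg.2 hα.2)
    linarith
  · rcases min_choice c₁ c₂ with h | h <;> rwa [h]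

theorem eQuasiconcaveOnB0_lowerEnvelope (K : Set ℝ) (φ : S → ℝ) (a : EReal) :
    EQuasiconcaveOnB0 K (lowerEnvelope φ a) := by
  intro α hα ψ₁ _ ψ₂ _
  refine le_of_forall_lt fun b hb => ?_
  obtain ⟨h₁, h₂⟩ := lt_min_iff.1 hb
  obtain ⟨c₁, ⟨hc₁, hle₁⟩, hb₁⟩ := by simpa only [lowerEnvelope, lt_iSup_iff, exists_prop] using h₁
  obtain ⟨c₂, ⟨hc₂, hle₂⟩, hb₂⟩ := by simpa only [lowerEnvelope, lt_iSup_iff, exists_prop] using h₂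
  refine lt_of_lt_of_le ?_
    (le_lowerEnvelope (c := min c₁ c₂) a (le_min hc₁ hc₂) fun s => ?_)
  · rcases min_choice c₁ c₂ with h | h <;> rwa [h]
  · have hm₁ := mul_le_mul_of_nonneg_left
      ((add_le_add_right (min_le_left c₁ c₂) (φ s)).trans (hle₁ s)) hα.1
    have hm₂ := mul_le_mul_of_nonneg_left
      ((add_le_add_right (min_le_right c₁ c₂) (φ s)).trans (hle₂ s)) (sub_nonneg.2 hα.2)
    linarith

theorem le_upperEnvelope_of_constSuperadd {K : Set ℝ} (hK : Convex ℝ K) {I : (S → ℝ) → EReal}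
    (hmono : EMonotoneOnB0 K I) (hadd : EConstSuperadd K I) {φ ψ : S → ℝ} (hφ : φ ∈ B0 K)
    (hψ : ψ ∈ B0 K) : I ψ ≤ upperEnvelope φ (I φ) ψ := by
  refine le_iInf₂ fun c hc => ?_
  rw [EReal.le_sub_iff_add_le (by simp) (by simp)]
  exact hadd.add_le_of_add_le hK hmono hψ hφ hc.1 hc.2

theorem lowerEnvelope_le_of_constSuperadd {K : Set ℝ} (hK : Convex ℝ K) {I : (S → ℝ) → EReal}
    (hmono : EMonotoneOnB0 K I) (hadd : EConstSuperadd K I) {φ ψ : S → ℝ} (hφ : φ ∈ B0 K)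
    (hψ : ψ ∈ B0 K) : lowerEnvelope φ (I φ) ψ ≤ I ψ :=
  iSup₂_le fun _ hc => hadd.add_le_of_add_le hK hmono hφ hψ hc.1 hc.2

/-- for a convex `K ⊆ ℝ` and a continuous `I : B₀(Σ,K) → ℝ̄`, the following
are equivalent: (i) `I` is monotone, normalized, and constant superadditive; (ii) `I` is the
pointwise minimum of a family of monotone, constant superadditive, quasiconvex functionals,
attaining `k` at constants; (iii) `I` is the pointwise maximum of a family of monotone,
constant superadditive, quasiconcave functionals, attaining `k` at constants. -/
theorem stmt_14 (K : Set ℝ) (hK : Convex ℝ K) (I : (S → ℝ) → EReal)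
    (hcont : EContinuousOnB0 K I) :
    ((EMonotoneOnB0 K I ∧ ENormalizedOnB0 K I ∧ EConstSuperadd K I) ↔
      (∃ Φ : Set ((S → ℝ) → EReal),
        (∀ J ∈ Φ, EMonotoneOnB0 K J ∧ EConstSuperadd K J ∧ EQuasiconvexOnB0 K J) ∧
        (∀ φ : S → ℝ, φ ∈ B0 K → (∀ J ∈ Φ, I φ ≤ J φ) ∧ ∃ J ∈ Φ, J φ = I φ) ∧
        (∀ k ∈ K, (∀ J ∈ Φ, (k : EReal) ≤ J (fun _ => k)) ∧
          ∃ J ∈ Φ, J (fun _ => k) = (k : EReal)))) ∧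
    ((EMonotoneOnB0 K I ∧ ENormalizedOnB0 K I ∧ EConstSuperadd K I) ↔
      (∃ Ψ : Set ((S → ℝ) → EReal),
        (∀ H ∈ Ψ, EMonotoneOnB0 K H ∧ EConstSuperadd K H ∧ EQuasiconcaveOnB0 K H) ∧
        (∀ φ : S → ℝ, φ ∈ B0 K → (∀ H ∈ Ψ, H φ ≤ I φ) ∧ ∃ H ∈ Ψ, H φ = I φ) ∧
        (∀ k ∈ K, (∀ H ∈ Ψ, H (fun _ => k) ≤ (k : EReal)) ∧
          ∃ H ∈ Ψ, H (fun _ => k) = (k : EReal)))) := by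
  refine ⟨⟨?_, ?_⟩, ⟨?_, ?_⟩⟩
  · rintro ⟨hmono, hnorm, hadd⟩
    have hrep : ∀ φ ∈ B0 K,
        (∀ J ∈ (fun χ => upperEnvelope χ (I χ)) '' B0 K, I φ ≤ J φ) ∧
          ∃ J ∈ (fun χ => upperEnvelope χ (I χ)) '' B0 K, J φ = I φ := by
      refine fun φ hφ => ⟨?_, _, ⟨φ, hφ, rfl⟩, (upperEnvelope_self_le φ (I φ)).antisymm
        (le_upperEnvelope_of_constSuperadd hK hmono hadd hφ hφ)⟩
      rintro _ ⟨χ, hχ, rfl⟩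
      exact le_upperEnvelope_of_constSuperadd hK hmono hadd hχ hφ
    refine ⟨(fun χ => upperEnvelope χ (I χ)) '' B0 K, ?_, hrep, fun k hk => ?_⟩
    · rintro _ ⟨χ, -, rfl⟩
      exact ⟨eMonotoneOnB0_upperEnvelope K χ _, eConstSuperadd_upperEnvelope K χ _,
        eQuasiconvexOnB0_upperEnvelope K χ _⟩
    · simpa only [hnorm k hk] using hrep _ (B0.const_mem hk)
  · rintro ⟨Φ, hΦ, hrep, hconst⟩
    refine ⟨fun φ hφ ψ hψ hle => ?_, fun k hk => ?_, fun φ hφ k hk hφk => ?_⟩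
    · obtain ⟨J, hJ, hJφ⟩ := (hrep φ hφ).2
      exact hJφ ▸ ((hrep ψ hψ).1 J hJ).trans ((hΦ J hJ).1 φ hφ ψ hψ hle)
    · obtain ⟨hle, J, hJ, hJk⟩ := hrep _ (B0.const_mem hk)
      obtain ⟨hle', J', hJ', hJk'⟩ := hconst k hk
      exact (hJk' ▸ hle J' hJ').antisymm (hJk ▸ hle' J hJ)
    · obtain ⟨J, hJ, hJφ⟩ := (hrep _ hφk).2
      rw [← hJφ]
      exact (add_le_add_left ((hrep φ hφ).1 J hJ) _).trans ((hΦ J hJ).2.1 φ hφ k hk hφk)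
  · rintro ⟨hmono, hnorm, hadd⟩
    have hrep : ∀ φ ∈ B0 K,
        (∀ H ∈ (fun χ => lowerEnvelope χ (I χ)) '' B0 K, H φ ≤ I φ) ∧
          ∃ H ∈ (fun χ => lowerEnvelope χ (I χ)) '' B0 K, H φ = I φ := by
      refine fun φ hφ => ⟨?_, _, ⟨φ, hφ, rfl⟩,
        (lowerEnvelope_le_of_constSuperadd hK hmono hadd hφ hφ).antisymm
          (le_lowerEnvelope_self φ (I φ))⟩
      rintro _ ⟨χ, hχ, rfl⟩
      exact lowerEnvelope_le_of_constSuperadd hK hmono hadd hχ hφ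
    refine ⟨(fun χ => lowerEnvelope χ (I χ)) '' B0 K, ?_, hrep, fun k hk => ?_⟩
    · rintro _ ⟨χ, -, rfl⟩
      exact ⟨eMonotoneOnB0_lowerEnvelope K χ _, eConstSuperadd_lowerEnvelope K χ _,
        eQuasiconcaveOnB0_lowerEnvelope K χ _⟩
    · simpa only [hnorm k hk] using hrep _ (B0.const_mem hk)
  · rintro ⟨Ψ, hΨ, hrep, hconst⟩
    refine ⟨fun φ hφ ψ hψ hle => ?_, fun k hk => ?_, fun φ hφ k hk hφk => ?_⟩
    · obtain ⟨H, hH, hHψ⟩ := (hrep ψ hψ).2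
      exact hHψ ▸ ((hΨ H hH).1 φ hφ ψ hψ hle).trans ((hrep φ hφ).1 H hH)
    · obtain ⟨hle, H, hH, hHk⟩ := hrep _ (B0.const_mem hk)
      obtain ⟨hle', H', hH', hHk'⟩ := hconst k hk
      exact (hHk ▸ hle' H hH).antisymm (hHk' ▸ hle H' hH')
    · obtain ⟨H, hH, hHφ⟩ := (hrep φ hφ).2
      rw [← hHφ]
      exact ((hΨ H hH).2.1 φ hφ k hk hφk).trans ((hrep _ hφk).1 H hH)
end
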